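/- An invertible unital linear map φ: Mₙ(ℂ) → Mₙ(ℂ) is q-pure if and only if φ⁻¹ has the form φ⁻¹(A) = A + YA + AY* for some Y ∈ Mₙ(ℂ) with Y = −Y* and tr(Y) = 0. -/

import Mathlib

open scoped ComplexOrder BigOperators
open Matrix

abbrev MatC (n : ℕ) := Matrix (Fin n) (Fin n) ℂ

/-- Complete positivity of a linear map on `Mₙ(ℂ)`:
for all finite families `Aᵢ`, `fᵢ`, `∑ ⟨fᵢ, φ(Aᵢ* Aⱼ) fⱼ⟩ ≥ 0`. -/
def IsCP {n : ℕ} (φ : Module.End ℂ (MatC n)) : Prop :=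
  ∀ (m : ℕ) (A : Fin m → MatC n) (f : Fin m → (Fin n → ℂ)),
    0 ≤ ∑ i, ∑ j, star (f i) ⬝ᵥ ((φ ((A i)ᴴ * A j)) *ᵥ f j)

/-- `φ` has no negative (real) eigenvalues. -/
def NoNegEig {n : ℕ} (φ : Module.End ℂ (MatC n)) : Prop :=
  ∀ r : ℝ, r < 0 → ¬ Module.End.HasEigenvalue φ (r : ℂ)

/-- `φ^(t) = φ ∘ (I + t φ)⁻¹`. -/
noncomputable def qRes {n : ℕ} (φ : Module.End ℂ (MatC n)) (t : ℝ) :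
    Module.End ℂ (MatC n) :=
  φ * Ring.inverse (1 + (t : ℂ) • φ)

/-- `φ` is q-positive. -/
def IsQPos {n : ℕ} (φ : Module.End ℂ (MatC n)) : Prop :=
  NoNegEig φ ∧ ∀ t : ℝ, 0 ≤ t → IsCP (qRes φ t)

/-- `φ ≥_q ψ` : `φ(I+tφ)⁻¹ − ψ(I+tψ)⁻¹` is completely positive for all `t ≥ 0`. -/
def qLE {n : ℕ} (ψ φ : Module.End ℂ (MatC n)) : Prop :=
  ∀ t : ℝ, 0 ≤ t → IsCP (qRes φ t - qRes ψ t)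

/-- `φ` is q-pure: its q-subordinates are exactly `{0} ∪ {φ^(s) : s ≥ 0}`. -/
def IsQPure {n : ℕ} (φ : Module.End ℂ (MatC n)) : Prop :=
  IsQPos φ ∧ ∀ ψ : Module.End ℂ (MatC n),
    (IsQPos ψ ∧ qLE ψ φ) ↔ (ψ = 0 ∨ ∃ s : ℝ, 0 ≤ s ∧ ψ = qRes φ s)


section general

variable {ι : Type*} [Fintype ι] [DecidableEq ι]

lemma psd_of_quad {C : Matrix ι ι ℂ} (h : ∀ x : ι → ℂ, 0 ≤ star x ⬝ᵥ (C *ᵥ x)) :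
    C.PosSemidef := by
  have key : C.toEuclideanLin.IsPositive := by
    rw [LinearMap.isPositive_iff_complex]
    intro x
    have h1 := h (WithLp.ofLp x)
    have h2 : inner ℂ (C.toEuclideanLin x) x = star (star (WithLp.ofLp x) ⬝ᵥ (C *ᵥ (WithLp.ofLp x))) := by
      rw [EuclideanSpace.inner_eq_star_dotProduct]
      rw [← star_dotProduct, Matrix.ofLp_toLpLin, Matrix.toLin'_apply, dotProduct_comm]
    rw [h2]
    rw [Complex.nonneg_iff] at h1
    constructor
    · apply Complex.ext
      · simp
      · simp [← h1.2]
    · simpa using h1.1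
  exact Matrix.isPositive_toEuclideanLin_iff.mp key

lemma psd_antisymm {C : Matrix ι ι ℂ} (h1 : C.PosSemidef) (h2 : (-C).PosSemidef) : C = 0 := by
  rw [← h1.trace_eq_zero_iff]
  have a := h1.trace_nonneg
  have b := h2.trace_nonneg
  rw [Matrix.trace_neg] at b
  exact le_antisymm (by simpa using b) a

lemma psd_lim {C : ℝ → Matrix ι ι ℂ} {D : Matrix ι ι ℂ}
    (hC : ∀ t, 0 ≤ t → (C t).PosSemidef) (hlim : Filter.Tendsto C Filter.atTop (nhds D)) :
    D.PosSemidef := by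
  have := Complex.orderClosedTopology
  apply psd_of_quad
  intro x
  have hc : Continuous fun M : Matrix ι ι ℂ => star x ⬝ᵥ (M *ᵥ x) := by fun_prop
  refine ge_of_tendsto ((hc.tendsto D).comp hlim) ?_
  filter_upwards [Filter.eventually_ge_atTop 0] with t ht
  exact (hC t ht).dotProduct_mulVec_nonneg x

/-- Cauchy-Schwarz for entries. -/
lemma psd_entry {C : Matrix ι ι ℂ} (h : C.PosSemidef) (a b : ι) :
    ‖C a b‖ ^ 2 ≤ (C a a).re * (C b b).re := by
  have h1 := (h.submatrix ![a, b]).det_nonneg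
  rw [Matrix.det_fin_two] at h1
  simp only [Matrix.submatrix_apply, Matrix.cons_val_zero, Matrix.cons_val_one] at h1
  have hba : C b a = star (C a b) := (h.1.apply b a).symm
  rw [hba] at h1
  have ha := Complex.nonneg_iff.mp (h.diag_nonneg (i := a))
  have hb := Complex.nonneg_iff.mp (h.diag_nonneg (i := b))
  have h2 := (Complex.nonneg_iff.mp h1).1
  simp only [Complex.sub_re, Complex.mul_re, ← ha.2, ← hb.2, Complex.star_def, Complex.conj_re, Complex.conj_im] at h2
  rw [← Complex.normSq_eq_norm_sq, Complex.normSq_apply]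
  linarith

lemma psd_entry' {C : Matrix ι ι ℂ} (h : C.PosSemidef) (P : Matrix ι ι ℂ) (a b : ι) :
    ‖(C * P) a b‖ ^ 2 ≤ (C a a).re * ((Pᴴ * C * P) b b).re := by
  have h1 := h.conjTranspose_mul_mul_same (Matrix.fromCols (1 : Matrix ι ι ℂ) P)
  have h2 := psd_entry h1 (Sum.inl a) (Sum.inr b)
  simpa [Matrix.conjTranspose_fromCols_eq_fromRows_conjTranspose, Matrix.fromRows_mul,
    Matrix.mul_fromCols, Matrix.mul_assoc] using h2

lemma psd_factor {C : Matrix ι ι ℂ} (h : C.PosSemidef) : ∃ G : Matrix ι ι ℂ, C = Gᴴ * G := by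
  open scoped MatrixOrder in
  exact CStarAlgebra.nonneg_iff_eq_star_mul_self.mp (Matrix.nonneg_iff_posSemidef.mpr h)

/-- Lyapunov. -/
lemma lyap_psd {B C : Matrix ι ι ℂ} (hB : (B + Bᴴ).PosDef) (hC : C.IsHermitian)
    (h : (B * C + C * Bᴴ).PosSemidef) : C.PosSemidef := by
  rw [hC.posSemidef_iff_eigenvalues_nonneg]
  intro j
  by_contra hneg
  simp only [Pi.zero_apply, not_le] at hneg
  set u : ι → ℂ := ⇑(hC.eigenvectorBasis j) with hu
  have hu0 : u ≠ 0 := by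
    intro h0
    have := hC.eigenvectorBasis.orthonormal.ne_zero j
    apply this
    ext i
    exact congrFun h0 i
  have he : C *ᵥ u = ((hC.eigenvalues j : ℝ) : ℂ) • u := by
    rw [hu, hC.mulVec_eigenvectorBasis j]
    ext i; simp
  have he' : star u ᵥ* C = ((hC.eigenvalues j : ℝ) : ℂ) • star u := by
    have := congrArg star he
    rw [Matrix.star_mulVec, hC.eq] at this
    rw [this]
    ext i; simp
  have h1 := h.dotProduct_mulVec_nonneg u
  have h2 := hB.dotProduct_mulVec_pos hu0
  have h3 : star u ⬝ᵥ ((B * C + C * Bᴴ) *ᵥ u)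
      = ((hC.eigenvalues j : ℝ) : ℂ) * (star u ⬝ᵥ ((B + Bᴴ) *ᵥ u)) := by
    rw [Matrix.add_mulVec, Matrix.add_mulVec, dotProduct_add, dotProduct_add,
      ← Matrix.mulVec_mulVec, ← Matrix.mulVec_mulVec, he, Matrix.dotProduct_mulVec _ C, he',
      Matrix.mulVec_smul, dotProduct_smul, smul_dotProduct]
    simp [mul_add]
  rw [h3] at h1
  have h1' := (Complex.nonneg_iff.mp h1).1
  have h2' := (Complex.pos_iff.mp h2)
  simp only [Complex.mul_re, Complex.ofReal_re, Complex.ofReal_im, zero_mul, sub_zero] at h1'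
  nlinarith [h2'.1]

lemma lyap_inj {B C : Matrix ι ι ℂ} (hB : (B + Bᴴ).PosDef)
    (h : B * C + C * Bᴴ = 0) : C = 0 := by
  have herm : ∀ D : Matrix ι ι ℂ, D.IsHermitian → B * D + D * Bᴴ = 0 → D = 0 := by
    intro D hD h0
    apply psd_antisymm
    · exact lyap_psd hB hD (by rw [h0]; exact .zero)
    · refine lyap_psd hB hD.neg ?_
      rw [Matrix.mul_neg, Matrix.neg_mul, ← neg_add, h0, neg_zero]; exact .zero
  have h' : B * Cᴴ + Cᴴ * Bᴴ = 0 := by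
    have := congrArg Matrix.conjTranspose h
    simp only [Matrix.conjTranspose_add, Matrix.conjTranspose_mul, Matrix.conjTranspose_conjTranspose,
      Matrix.conjTranspose_zero] at this
    rw [add_comm]; exact this
  have h1 : C + Cᴴ = 0 := by
    apply herm
    · exact Matrix.isHermitian_add_transpose_self C
    · rw [mul_add, add_mul]
      calc _ = (B * C + C * Bᴴ) + (B * Cᴴ + Cᴴ * Bᴴ) := by abel
        _ = 0 := by rw [h, h', add_zero]
  have h2 : Complex.I • (C - Cᴴ) = 0 := by
    apply herm
    · simp [Matrix.IsHermitian, Matrix.conjTranspose_smul, ← smul_neg]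
    · rw [Matrix.mul_smul, Matrix.smul_mul, ← smul_add, mul_sub, sub_mul]
      have : (B * C - B * Cᴴ + (C * Bᴴ - Cᴴ * Bᴴ)) = (B * C + C * Bᴴ) - (B * Cᴴ + Cᴴ * Bᴴ) := by abel
      rw [this, h, h']; simp
  have h3 : C - Cᴴ = 0 := by
    rcases smul_eq_zero.mp h2 with h | h
    · exact absurd h Complex.I_ne_zero
    · exact h
  have h4 : (2:ℂ) • C = 0 := by
    have : (2:ℂ) • C = (C + Cᴴ) + (C - Cᴴ) := by rw [two_smul]; abel
    rw [this, h1, h3, add_zero]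
  rcases smul_eq_zero.mp h4 with h | h
  · norm_num at h
  · exact h

lemma lyap_psd' {B C : Matrix ι ι ℂ} (hB : (B + Bᴴ).PosDef)
    (h : (B * C + C * Bᴴ).PosSemidef) : C.PosSemidef := by
  refine lyap_psd hB ?_ h
  have h1 := h.1.eq
  simp only [Matrix.conjTranspose_add, Matrix.conjTranspose_mul, Matrix.conjTranspose_conjTranspose] at h1
  have : Cᴴ - C = 0 := by
    apply lyap_inj hB
    rw [mul_sub, sub_mul]
    have e : B * Cᴴ - B * C + (Cᴴ * Bᴴ - C * Bᴴ) = (B * Cᴴ + Cᴴ * Bᴴ) - (B * C + C * Bᴴ) := by abel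
    rw [e, sub_eq_zero, ← h1]; abel
  exact sub_eq_zero.mp this

end general

section choi

variable {n : ℕ}

/-- Choi matrix. -/
def choi (φ : Module.End ℂ (MatC n)) : Matrix (Fin n × Fin n) (Fin n × Fin n) ℂ :=
  Matrix.of fun a b => φ (Matrix.single a.1 b.1 1) a.2 b.2

lemma choi_apply (φ : Module.End ℂ (MatC n)) (a b : Fin n × Fin n) :
    choi φ a b = φ (Matrix.single a.1 b.1 1) a.2 b.2 := rfl

lemma choi_add (φ ψ : Module.End ℂ (MatC n)) : choi (φ + ψ) = choi φ + choi ψ := by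
  ext a b; simp [choi_apply]

lemma choi_sub (φ ψ : Module.End ℂ (MatC n)) : choi (φ - ψ) = choi φ - choi ψ := by
  ext a b; simp [choi_apply]

lemma choi_neg (φ : Module.End ℂ (MatC n)) : choi (-φ) = -choi φ := by
  ext a b; simp [choi_apply]

lemma choi_smul (c : ℂ) (φ : Module.End ℂ (MatC n)) : choi (c • φ) = c • choi φ := by
  ext a b; simp [choi_apply]

lemma choi_zero : choi (0 : Module.End ℂ (MatC n)) = 0 := by
  ext a b; simp [choi_apply]

lemma map_entry (φ : Module.End ℂ (MatC n)) (A : MatC n) (k l : Fin n) :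
    φ A k l = ∑ i, ∑ j, A i j * choi φ (i, k) (j, l) := by
  conv_lhs => rw [Matrix.matrix_eq_sum_single A]
  simp only [map_sum, Matrix.sum_apply, choi_apply]
  refine Finset.sum_congr rfl fun i _ => Finset.sum_congr rfl fun j _ => ?_
  have : Matrix.single i j (A i j) = A i j • Matrix.single i j (1:ℂ) := by simp
  rw [this, map_smul]; simp

lemma choi_inj {φ ψ : Module.End ℂ (MatC n)} (h : choi φ = choi ψ) : φ = ψ := by
  ext A k l
  rw [map_entry, map_entry, h]

lemma trace_choi (φ : Module.End ℂ (MatC n)) : (choi φ).trace = (φ 1).trace := by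
  simp only [Matrix.trace, Matrix.diag_apply, map_entry φ 1, Fintype.sum_prod_type]
  rw [Finset.sum_comm]
  simp [Matrix.one_apply]

lemma choi_psd_of_cp [NeZero n] {φ : Module.End ℂ (MatC n)} (h : IsCP φ) : (choi φ).PosSemidef := by
  apply psd_of_quad
  intro x
  have h1 := h n (fun i => Matrix.single 0 i 1) (fun i k => x (i, k))
  convert h1 using 1
  simp only [Matrix.conjTranspose_single, Matrix.single_mul_single_same, star_one, mul_one,
    dotProduct, Matrix.mulVec, Pi.star_apply, Fintype.sum_prod_type, choi_apply, Finset.mul_sum]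
  refine Finset.sum_congr rfl fun i _ => ?_
  rw [Finset.sum_comm]

lemma kraus_of_psd {φ : Module.End ℂ (MatC n)} (h : (choi φ).PosSemidef) :
    ∃ K : Fin n × Fin n → MatC n, ∀ A, φ A = ∑ p, K p * A * (K p)ᴴ := by
  obtain ⟨G, hG⟩ := psd_factor h
  refine ⟨fun p => Matrix.of fun k i => star (G p (i, k)), fun A => ?_⟩
  ext k l
  rw [map_entry, hG, Matrix.sum_apply]
  simp only [Matrix.mul_apply, Matrix.conjTranspose_apply, Matrix.of_apply, star_star, Finset.mul_sum, Finset.sum_mul]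
  simp_rw [Finset.sum_comm (s := Finset.univ (α := Fin n)) (t := Finset.univ (α := Fin n × Fin n))]
  refine Finset.sum_congr rfl fun p _ => ?_
  rw [Finset.sum_comm]
  refine Finset.sum_congr rfl fun i _ => Finset.sum_congr rfl fun j _ => ?_
  ring

lemma cp_of_kraus {φ : Module.End ℂ (MatC n)} {κ : Type*} [Fintype κ] {K : κ → MatC n}
    (h : ∀ A, φ A = ∑ p, K p * A * (K p)ᴴ) : IsCP φ := by
  intro m A f
  have : ∑ i, ∑ j, star (f i) ⬝ᵥ ((φ ((A i)ᴴ * A j)) *ᵥ f j)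
      = ∑ p, star (∑ i, (A i * (K p)ᴴ) *ᵥ f i) ⬝ᵥ (∑ j, (A j * (K p)ᴴ) *ᵥ f j) := by
    simp only [h, star_sum, sum_dotProduct, dotProduct_sum, Matrix.sum_mulVec]
    simp_rw [Finset.sum_comm (s := Finset.univ (α := Fin m)) (t := Finset.univ (α := κ))]
    refine Finset.sum_congr rfl fun p _ => ?_
    rw [Finset.sum_comm]
    refine Finset.sum_congr rfl fun i _ => Finset.sum_congr rfl fun j _ => ?_
    rw [Matrix.star_mulVec, ← Matrix.dotProduct_mulVec, Matrix.mulVec_mulVec]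
    simp [Matrix.mul_assoc]
  rw [this]
  exact Finset.sum_nonneg fun p _ => dotProduct_star_self_nonneg _

lemma cp_iff [NeZero n] {φ : Module.End ℂ (MatC n)} : IsCP φ ↔ (choi φ).PosSemidef :=
  ⟨choi_psd_of_cp, fun h => let ⟨_, hK⟩ := kraus_of_psd h; cp_of_kraus hK⟩

lemma cp_comp [NeZero n] {φ ψ : Module.End ℂ (MatC n)} (h1 : IsCP φ) (h2 : IsCP ψ) : IsCP (φ * ψ) := by
  obtain ⟨K, hK⟩ := kraus_of_psd (cp_iff.mp h1)
  obtain ⟨J, hJ⟩ := kraus_of_psd (cp_iff.mp h2)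
  apply cp_of_kraus (κ := (Fin n × Fin n) × (Fin n × Fin n)) (K := fun p => K p.1 * J p.2)
  intro A
  simp only [Module.End.mul_apply, hJ A, hK, Matrix.mul_sum, Matrix.sum_mul,
    Matrix.conjTranspose_mul, Matrix.mul_assoc]
  symm
  refine (Fintype.sum_prod_type _).trans ?_
  rfl

lemma cp_smul [NeZero n] {φ : Module.End ℂ (MatC n)} (h1 : IsCP φ) {c : ℝ} (hc : 0 ≤ c) :
    IsCP ((c : ℂ) • φ) := by
  rw [cp_iff, choi_smul]
  exact (cp_iff.mp h1).smul (by exact_mod_cast hc)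

lemma cp_zero : IsCP (0 : Module.End ℂ (MatC n)) := by
  intro m A f; simp

end choi

section lyapunov

variable {n : ℕ}

/-- The map `A ↦ B A + A B*`. -/
noncomputable def lyap (B : MatC n) : Module.End ℂ (MatC n) :=
  LinearMap.mulLeft ℂ B + LinearMap.mulRight ℂ Bᴴ

lemma lyap_apply (B A : MatC n) : lyap B A = B * A + A * Bᴴ := rfl

/-- The vectorised identity. -/
def vv (n : ℕ) : Fin n × Fin n → ℂ := fun a => if a.1 = a.2 then 1 else 0

lemma star_vv : star (vv n) = vv n := by
  ext a; by_cases h : a.1 = a.2 <;> simp [vv, h]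

/-- Choi matrix of the identity. -/
def EE (n : ℕ) : Matrix (Fin n × Fin n) (Fin n × Fin n) ℂ := Matrix.vecMulVec (vv n) (vv n)

lemma choi_one : choi (1 : Module.End ℂ (MatC n)) = EE n := by
  ext ⟨i, k⟩ ⟨j, l⟩
  simp [choi_apply, EE, Matrix.vecMulVec_apply, vv, Matrix.single_apply, ← ite_and, and_comm]

lemma EE_psd : (EE n).PosSemidef := by
  have := Matrix.posSemidef_vecMulVec_self_star (vv n)
  rwa [star_vv] at this

lemma vv_dot : vv n ⬝ᵥ vv n = n := by
  simp [dotProduct, vv, Fintype.sum_prod_type]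

lemma EE_mul_EE : EE n * EE n = (n : ℂ) • EE n := by
  rw [EE, Matrix.vecMulVec_mul_vecMulVec, vv_dot]
  ext a b
  simp [Matrix.vecMulVec_apply]
  ring

lemma EE_mul_mul_EE (C : Matrix (Fin n × Fin n) (Fin n × Fin n) ℂ) :
    EE n * C * EE n = (vv n ⬝ᵥ (C *ᵥ vv n)) • EE n := by
  rw [EE, Matrix.vecMulVec_mul, Matrix.vecMulVec_mul_vecMulVec, Matrix.dotProduct_mulVec]
  ext a b
  simp only [Matrix.vecMulVec_apply, Matrix.smul_apply, smul_eq_mul, Pi.smul_apply]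
  ring

/-- Projection onto the identity. -/
noncomputable def QQ (n : ℕ) : Matrix (Fin n × Fin n) (Fin n × Fin n) ℂ := (n : ℂ)⁻¹ • EE n

/-- Complementary projection. -/
noncomputable def PP (n : ℕ) : Matrix (Fin n × Fin n) (Fin n × Fin n) ℂ := 1 - QQ n

lemma QQ_herm : (QQ n)ᴴ = QQ n := by
  rw [QQ, Matrix.conjTranspose_smul, EE_psd.1.eq]; simp

lemma PP_herm : (PP n)ᴴ = PP n := by
  rw [PP, Matrix.conjTranspose_sub, QQ_herm]; simp

lemma PP_mul_EE [NeZero n] : PP n * EE n = 0 := by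
  have : (n : ℂ) ≠ 0 := by exact_mod_cast NeZero.ne n
  rw [PP, QQ, sub_mul, one_mul, Matrix.smul_mul, EE_mul_EE, smul_smul, inv_mul_cancel₀ this]
  simp

lemma EE_mul_PP [NeZero n] : EE n * PP n = 0 := by
  have := congrArg Matrix.conjTranspose (PP_mul_EE (n := n))
  rwa [Matrix.conjTranspose_mul, PP_herm, EE_psd.1.eq, Matrix.conjTranspose_zero] at this

lemma QQ_mul_mul_QQ (C : Matrix (Fin n × Fin n) (Fin n × Fin n) ℂ) :
    QQ n * C * QQ n = ((n : ℂ)⁻¹ ^ 2 * (vv n ⬝ᵥ (C *ᵥ vv n))) • EE n := by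
  rw [QQ, Matrix.smul_mul, Matrix.smul_mul, Matrix.mul_smul, EE_mul_mul_EE, smul_smul, smul_smul]
  ring_nf

lemma EE_ne_zero [NeZero n] : EE n ≠ 0 := by
  intro h
  have := congrFun (congrFun h (0, 0)) (0, 0)
  simp [EE, Matrix.vecMulVec_apply, vv] at this

lemma vec_apply (w : Fin n × Fin n → ℂ) (Z : MatC n) (hZ : ∀ i k, w (i, k) = Z k i) :
    choi (lyap Z) = Matrix.vecMulVec w (vv n) + Matrix.vecMulVec (vv n) (star w) := by
  ext ⟨i, k⟩ ⟨j, l⟩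
  simp [choi_apply, lyap_apply, Matrix.vecMulVec_apply, vv, hZ, Matrix.mul_apply, Matrix.single_apply,
    ite_and]

lemma choi_mulLeft (B : MatC n) (R : Module.End ℂ (MatC n)) :
    choi (LinearMap.mulLeft ℂ B * R) = (Matrix.kronecker (1 : MatC n) B) * choi R := by
  ext ⟨i, k⟩ ⟨j, l⟩
  simp [choi_apply, Matrix.mul_apply, Fintype.sum_prod_type, Matrix.one_apply]

lemma choi_mulRight (B : MatC n) (R : Module.End ℂ (MatC n)) :
    choi (LinearMap.mulRight ℂ B * R) = choi R * (Matrix.kronecker (1 : MatC n) B) := by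
  ext ⟨i, k⟩ ⟨j, l⟩
  simp [choi_apply, Matrix.mul_apply, Fintype.sum_prod_type, Matrix.one_apply]

lemma lyap_inverse [NeZero n] {B : MatC n} (hB : (B + Bᴴ).PosDef) :
    ∃ R : Module.End ℂ (MatC n), lyap B * R = 1 ∧ R * lyap B = 1 ∧ IsCP R := by
  have hu : IsUnit (lyap B) := by
    rw [LinearMap.isUnit_iff_ker_eq_bot, LinearMap.ker_eq_bot']
    intro A hA
    exact lyap_inj hB hA
  obtain ⟨u, hu⟩ := hu
  refine ⟨↑u⁻¹, by rw [← hu]; simp, by rw [← hu]; simp, ?_⟩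
  rw [cp_iff]
  have hB' : (Matrix.kronecker (1 : MatC n) B + (Matrix.kronecker (1 : MatC n) B)ᴴ).PosDef := by
    have h := Matrix.PosDef.kronecker (Matrix.PosDef.one (n := Fin n) (R := ℂ)) hB
    have e : Matrix.kronecker (1 : MatC n) B + (Matrix.kronecker (1 : MatC n) B)ᴴ
      = Matrix.kronecker (1 : MatC n) (B + Bᴴ) := by
      rw [Matrix.kronecker, Matrix.conjTranspose_kronecker, Matrix.conjTranspose_one, ← Matrix.kronecker_add]
    rw [e]; exact h
  apply lyap_psd' hB'
  have e2 : (Matrix.kronecker (1 : MatC n) B)ᴴ = Matrix.kronecker (1 : MatC n) Bᴴ := by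
    rw [Matrix.kronecker, Matrix.conjTranspose_kronecker, Matrix.conjTranspose_one]
  rw [e2, ← choi_mulLeft, ← choi_mulRight, ← choi_add, ← add_mul]
  have : (LinearMap.mulLeft ℂ B + LinearMap.mulRight ℂ Bᴴ) = (u : Module.End ℂ (MatC n)) := hu.symm
  rw [this, Units.mul_inv, choi_one]
  exact EE_psd

end lyapunov

section limits

open Filter Topology

variable {n : ℕ}

lemma tendsto_matrix {ι : Type*} {f : ℝ → Matrix ι ι ℂ} {M : Matrix ι ι ℂ} :
    Tendsto f atTop (𝓝 M) ↔ ∀ i j, Tendsto (fun t => f t i j) atTop (𝓝 (M i j)) := by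
  constructor
  · intro h i j
    have hc : Continuous fun N : Matrix ι ι ℂ => N i j := by fun_prop
    exact (hc.tendsto M).comp h
  · intro h
    exact tendsto_pi_nhds.mpr fun i => tendsto_pi_nhds.mpr fun j => h i j

lemma tendsto_choi {R : ℝ → Module.End ℂ (MatC n)} {S : Module.End ℂ (MatC n)} :
    Tendsto (fun t => choi (R t)) atTop (𝓝 (choi S)) ↔
      ∀ A, Tendsto (fun t => R t A) atTop (𝓝 (S A)) := by
  constructor
  · intro h A
    refine tendsto_matrix.mpr fun k l => ?_
    simp only [map_entry]
    refine tendsto_finsetSum _ fun i _ => tendsto_finsetSum _ fun j _ => ?_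
    refine Tendsto.const_mul _ ?_
    exact tendsto_matrix.mp h (i, k) (j, l)
  · intro h
    refine tendsto_matrix.mpr fun a b => ?_
    exact tendsto_matrix.mp (h (Matrix.single a.1 b.1 1)) a.2 b.2

lemma tendsto_choi_mul (L : Module.End ℂ (MatC n)) {R : ℝ → Module.End ℂ (MatC n)}
    (h : Tendsto (fun t => choi (R t)) atTop (𝓝 0)) :
    Tendsto (fun t => choi (L * R t)) atTop (𝓝 0) := by
  rw [← choi_zero, tendsto_choi] at h ⊢
  intro A
  have hc : Continuous L := LinearMap.continuous_of_finiteDimensional L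
  have := (hc.tendsto _).comp (h A)
  simpa [Function.comp_def] using this

lemma norm_sq_tendsto {f : ℝ → ℂ} {g : ℝ → ℝ} (h : ∀ t, 0 ≤ t → ‖f t‖ ^ 2 ≤ g t)
    (hg : Tendsto g atTop (𝓝 0)) : Tendsto f atTop (𝓝 0) := by
  have h1 : Tendsto (fun t => Real.sqrt (g t)) atTop (𝓝 0) := by
    have := (Real.continuous_sqrt.tendsto 0).comp hg
    simpa [Function.comp_def] using this
  refine squeeze_zero_norm' ?_ h1
  filter_upwards [eventually_ge_atTop 0] with t ht
  exact Real.le_sqrt_of_sq_le (h t ht)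

lemma psd_small {ι : Type*} [Fintype ι] [DecidableEq ι] {C : ℝ → Matrix ι ι ℂ}
    (hC : ∀ t, 0 ≤ t → (C t).PosSemidef)
    (h : Tendsto (fun t => (C t).trace.re) atTop (𝓝 0)) : Tendsto C atTop (𝓝 0) := by
  refine tendsto_matrix.mpr fun a b => ?_
  have hd : ∀ t, 0 ≤ t → ∀ c, 0 ≤ (C t c c).re := fun t ht c =>
    (Complex.nonneg_iff.mp ((hC t ht).diag_nonneg (i := c))).1
  have hle : ∀ t, 0 ≤ t → ∀ c, (C t c c).re ≤ (C t).trace.re := by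
    intro t ht c
    simp only [Matrix.trace, Complex.re_sum, Matrix.diag_apply]
    exact Finset.single_le_sum (f := fun i => (C t i i).re) (fun i _ => hd t ht i) (Finset.mem_univ c)
  refine norm_sq_tendsto (g := fun t => (C t).trace.re * (C t).trace.re) ?_ (by simpa using h.mul h)
  intro t ht
  refine (psd_entry (hC t ht) a b).trans ?_
  exact mul_le_mul (hle t ht a) (hle t ht b) (hd t ht b) ((hd t ht a).trans (hle t ht a))

lemma resolvent_lim {L : Module.End ℂ (MatC n)} {R : ℝ → Module.End ℂ (MatC n)}
    (hR : ∀ t : ℝ, 0 ≤ t → (L + (t : ℂ) • 1) * R t = 1)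
    (h : Tendsto (fun t => choi (R t)) atTop (𝓝 0)) :
    Tendsto (fun t : ℝ => ((t : ℂ) ^ 2) • choi (R t) - (t : ℂ) • EE n) atTop (𝓝 (- choi L)) := by
  have h1 := (tendsto_choi_mul (L * L) h).const_add (- choi L)
  rw [add_zero] at h1
  refine h1.congr' ?_
  filter_upwards [eventually_ge_atTop 0] with t ht
  rw [← choi_one, ← choi_smul, ← choi_smul, ← choi_sub, ← choi_neg, ← choi_add]
  congr 1
  have e := hR t ht
  rw [add_mul, smul_mul_assoc, one_mul] at e
  have e1 : (t : ℂ) • R t = 1 - L * R t := by rw [← e]; abel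
  have e2 : (t : ℂ) ^ 2 • R t = (t : ℂ) • (1 : Module.End ℂ (MatC n)) - L * (1 - L * R t) := by
    rw [← e1, pow_two, mul_smul, mul_smul_comm]
    conv_lhs => rw [e1]
    exact smul_sub _ _ _
  rw [e2, mul_sub, mul_one, mul_assoc]; abel

/-- First-order limit: `t R_t → 1`. -/
lemma resolvent_lim1 {L : Module.End ℂ (MatC n)} {R : ℝ → Module.End ℂ (MatC n)}
    (hR : ∀ t : ℝ, 0 ≤ t → (L + (t : ℂ) • 1) * R t = 1)
    (h : Tendsto (fun t => choi (R t)) atTop (𝓝 0)) :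
    Tendsto (fun t : ℝ => (t : ℂ) • choi (R t)) atTop (𝓝 (EE n)) := by
  have h1 := (tendsto_choi_mul L h).const_sub (EE n)
  rw [sub_zero] at h1
  refine h1.congr' ?_
  filter_upwards [eventually_ge_atTop 0] with t ht
  rw [← choi_one, ← choi_smul, ← choi_sub]
  congr 1
  have e := hR t ht
  rw [add_mul, smul_mul_assoc, one_mul] at e
  rw [← e]; abel

/-- Conditional negativity of the inverse. -/
lemma cond_neg [NeZero n] {L : Module.End ℂ (MatC n)} {R : ℝ → Module.End ℂ (MatC n)}
    (hR : ∀ t : ℝ, 0 ≤ t → (L + (t : ℂ) • 1) * R t = 1)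
    (hcp : ∀ t : ℝ, 0 ≤ t → IsCP (R t))
    (h : Tendsto (fun t => choi (R t)) atTop (𝓝 0)) :
    (-(PP n * choi L * PP n)).PosSemidef := by
  have h1 := resolvent_lim hR h
  have hc : Continuous fun M : Matrix (Fin n × Fin n) (Fin n × Fin n) ℂ => PP n * M * PP n := by
    fun_prop
  have h2 := (hc.tendsto _).comp h1
  rw [Matrix.mul_neg, Matrix.neg_mul] at h2
  refine psd_lim ?_ h2
  intro t ht
  have e : PP n * ((t : ℂ) ^ 2 • choi (R t) - (t : ℂ) • EE n) * PP n
      = (t : ℂ) ^ 2 • ((PP n)ᴴ * choi (R t) * PP n) := by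
    rw [PP_herm, mul_sub, Matrix.mul_smul, Matrix.mul_smul, PP_mul_EE, smul_zero, sub_zero, Matrix.smul_mul]
  simp only [Function.comp]
  rw [e]
  refine ((cp_iff.mp (hcp t ht)).conjTranspose_mul_mul_same _).smul ?_
  rw [← Complex.ofReal_pow]
  exact_mod_cast sq_nonneg t

lemma choi_herm [NeZero n] {L : Module.End ℂ (MatC n)} {R : ℝ → Module.End ℂ (MatC n)}
    (hR : ∀ t : ℝ, 0 ≤ t → (L + (t : ℂ) • 1) * R t = 1)
    (hcp : ∀ t : ℝ, 0 ≤ t → IsCP (R t))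
    (h : Tendsto (fun t => choi (R t)) atTop (𝓝 0)) : (choi L).IsHermitian := by
  have h1 := resolvent_lim hR h
  have hc : Continuous fun M : Matrix (Fin n × Fin n) (Fin n × Fin n) ℂ => Mᴴ := by fun_prop
  have h2 := (hc.tendsto _).comp h1
  have h3 := h2.congr' (f₂ := fun t : ℝ => ((t : ℂ) ^ 2) • choi (R t) - (t : ℂ) • EE n) (by
    filter_upwards [eventually_ge_atTop 0] with t ht
    have h4 := (cp_iff.mp (hcp t ht)).1.eq
    simp [Matrix.conjTranspose_smul, h4, EE_psd.1.eq])
  have := tendsto_nhds_unique h3 h1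
  rw [Matrix.conjTranspose_neg, neg_inj] at this
  exact this

/-- Domination by something tending to a rank one multiple of `EE`. -/
lemma squeeze_EE [NeZero n] {C D : ℝ → Matrix (Fin n × Fin n) (Fin n × Fin n) ℂ}
    {D' : Matrix (Fin n × Fin n) (Fin n × Fin n) ℂ}
    (hC : ∀ t, 0 ≤ t → (C t).PosSemidef) (hD : ∀ t, 0 ≤ t → (D t - C t).PosSemidef)
    (hlim : Tendsto D atTop (𝓝 D')) (hD' : PP n * D' * PP n = 0) :
    Tendsto (fun t => C t - ((n : ℂ)⁻¹ ^ 2 * (vv n ⬝ᵥ (C t *ᵥ vv n))) • EE n) atTop (𝓝 0) := by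
  have hCP : Tendsto (fun t => C t * PP n) atTop (𝓝 0) := by
    refine tendsto_matrix.mpr fun a b => ?_
    refine norm_sq_tendsto (g := fun t => (D t a a).re * ((PP n * D t * PP n) b b).re) ?_ ?_
    · intro t ht
      refine (psd_entry' (hC t ht) (PP n) a b).trans ?_
      have a1 := (Complex.nonneg_iff.mp ((hC t ht).diag_nonneg (i := a))).1
      have a2 := (Complex.nonneg_iff.mp ((hD t ht).diag_nonneg (i := a))).1
      have b1 := (Complex.nonneg_iff.mp (((hC t ht).conjTranspose_mul_mul_same (PP n)).diag_nonneg (i := b))).1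
      have b2 := (Complex.nonneg_iff.mp (((hD t ht).conjTranspose_mul_mul_same (PP n)).diag_nonneg (i := b))).1
      rw [mul_sub, sub_mul] at b2
      rw [PP_herm] at *
      simp only [Matrix.sub_apply, Complex.sub_re] at a2 b2
      exact mul_le_mul (by linarith) (by linarith) b1 (by linarith)
    · have c1 : Continuous fun M : Matrix (Fin n × Fin n) (Fin n × Fin n) ℂ =>
          (M a a).re * ((PP n * M * PP n) b b).re := by fun_prop
      have := (c1.tendsto D').comp hlim
      rw [hD'] at this
      simpa [Function.comp_def] using this
  have hc : Continuous fun M : Matrix (Fin n × Fin n) (Fin n × Fin n) ℂ => M + Mᴴ * QQ n := by fun_prop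
  have h2 := (hc.tendsto 0).comp hCP
  simp only [Matrix.conjTranspose_zero, zero_mul, add_zero] at h2
  refine h2.congr' ?_
  filter_upwards [eventually_ge_atTop 0] with t ht
  simp only [Function.comp]
  rw [← QQ_mul_mul_QQ, Matrix.conjTranspose_mul, PP_herm, (hC t ht).1.eq, PP]
  noncomm_ring

/-- A map with CP-like Choi matrix vanishing off the identity is a multiple of the identity. -/
lemma eq_smul_one [NeZero n] {S : Module.End ℂ (MatC n)} (hS : (choi S).PosSemidef)
    (h : PP n * choi S * PP n = 0) : ∃ s : ℝ, 0 ≤ s ∧ S = (s : ℂ) • 1 := by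
  have h1 := squeeze_EE (C := fun _ => choi S) (D := fun _ => choi S) (fun _ _ => hS)
    (fun _ _ => by rw [sub_self]; exact .zero) tendsto_const_nhds h
  have h2 := tendsto_nhds_unique tendsto_const_nhds h1
  have h3 := hS.dotProduct_mulVec_nonneg (vv n)
  rw [star_vv] at h3
  have h4 : 0 ≤ (n : ℂ)⁻¹ ^ 2 * (vv n ⬝ᵥ (choi S *ᵥ vv n)) := by
    refine mul_nonneg ?_ h3
    have : ((n : ℂ)⁻¹ ^ 2) = (((n : ℝ)⁻¹ ^ 2 : ℝ) : ℂ) := by push_cast; rfl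
    rw [this]
    exact Complex.zero_le_real.mpr (sq_nonneg _)
  obtain ⟨h5, h6⟩ := Complex.nonneg_iff.mp h4
  refine ⟨_, h5, ?_⟩
  apply choi_inj
  rw [choi_smul, choi_one]
  have h7 := (sub_eq_zero.mp h2)
  conv_lhs => rw [h7]
  congr 1
  apply Complex.ext
  · simp only [Complex.ofReal_re]
  · simp only [Complex.ofReal_im]; exact h6.symm

end limits

section qres

open Filter Topology

variable {n : ℕ}

lemma unit_of_noneg {φ : Module.End ℂ (MatC n)} (h : NoNegEig φ) {t : ℝ} (ht : 0 ≤ t) :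
    IsUnit (1 + (t : ℂ) • φ) := by
  rw [LinearMap.isUnit_iff_ker_eq_bot, LinearMap.ker_eq_bot']
  intro A hA
  rcases ht.eq_or_lt with h0 | h0
  · subst h0; simpa using hA
  by_contra hne
  apply h (-t⁻¹) (by simpa using h0)
  refine Module.End.hasEigenvalue_of_hasEigenvector (x := A) ⟨?_, hne⟩
  rw [Module.End.mem_eigenspace_iff]
  have h1 : A + (t : ℂ) • φ A = 0 := by simpa using hA
  have ht' : (t : ℂ) ≠ 0 := by exact_mod_cast h0.ne'
  have h2 : (t : ℂ) • φ A = - A := by rw [eq_neg_iff_add_eq_zero, add_comm]; exact h1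
  calc φ A = (t : ℂ)⁻¹ • ((t : ℂ) • φ A) := by rw [smul_smul, inv_mul_cancel₀ ht', one_smul]
    _ = _ := by rw [h2]; push_cast; rw [neg_smul, smul_neg]

lemma qRes_right {φ : Module.End ℂ (MatC n)} (h : NoNegEig φ) {t : ℝ} (ht : 0 ≤ t) :
    qRes φ t * (1 + (t : ℂ) • φ) = φ := by
  rw [qRes, Ring.inverse_mul_cancel_right _ _ (unit_of_noneg h ht)]

lemma qRes_left {φ : Module.End ℂ (MatC n)} (h : NoNegEig φ) {t : ℝ} (ht : 0 ≤ t) :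
    (1 + (t : ℂ) • φ) * qRes φ t = φ := by
  have e : (1 + (t : ℂ) • φ) * φ = φ * (1 + (t : ℂ) • φ) := by
    rw [add_mul, mul_add, smul_mul_assoc, mul_smul_comm, one_mul, mul_one]
  rw [qRes, ← mul_assoc, e, mul_assoc, Ring.mul_inverse_cancel _ (unit_of_noneg h ht), mul_one]

lemma res_left {φ L : Module.End ℂ (MatC n)} (hL : L * φ = 1) (h : NoNegEig φ) {t : ℝ} (ht : 0 ≤ t) :
    (L + (t : ℂ) • 1) * qRes φ t = 1 := by
  have e : L + (t : ℂ) • 1 = L * (1 + (t : ℂ) • φ) := by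
    rw [mul_add, mul_smul_comm, hL, mul_one]
  rw [e, mul_assoc, qRes_left h ht, hL]

lemma res_right {φ L : Module.End ℂ (MatC n)} (hL : φ * L = 1) (h : NoNegEig φ) {t : ℝ} (ht : 0 ≤ t) :
    qRes φ t * (L + (t : ℂ) • 1) = 1 := by
  have e : L + (t : ℂ) • 1 = (1 + (t : ℂ) • φ) * L := by
    rw [add_mul, smul_mul_assoc, hL, one_mul]
  rw [e, ← mul_assoc, qRes_right h ht, hL]

lemma qpos_of_inv {φ L : Module.End ℂ (MatC n)} {R : ℝ → Module.End ℂ (MatC n)}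
    (hL : L * φ = 1)
    (h1 : ∀ t : ℝ, 0 ≤ t → R t * (L + (t : ℂ) • 1) = 1)
    (h3 : ∀ t : ℝ, 0 ≤ t → IsCP (R t)) :
    IsQPos φ ∧ ∀ t : ℝ, 0 ≤ t → qRes φ t = R t := by
  have hn : NoNegEig φ := by
    intro r hr he
    obtain ⟨A, hA⟩ := he.exists_hasEigenvector
    have hr' : (r : ℂ) ≠ 0 := by exact_mod_cast hr.ne
    have e1 : φ A = (r : ℂ) • A := hA.apply_eq_smul
    have e2 : L (φ A) = A := by rw [← Module.End.mul_apply, hL]; rfl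
    rw [e1, map_smul] at e2
    have e3 : (L + ((-r⁻¹ : ℝ) : ℂ) • 1) A = 0 := by
      simp only [LinearMap.add_apply, LinearMap.smul_apply, Module.End.one_apply]
      have : L A = (r : ℂ)⁻¹ • A := by
        conv_rhs => rw [← e2]
        rw [smul_smul, inv_mul_cancel₀ hr', one_smul]
      rw [this, Complex.ofReal_neg, Complex.ofReal_inv, neg_smul, add_neg_cancel]
    have e4 := congrArg (R (-r⁻¹)) e3
    rw [← Module.End.mul_apply, h1 _ (by simpa using hr.le), map_zero] at e4
    exact hA.2 e4
  have he : ∀ t : ℝ, 0 ≤ t → qRes φ t = R t := by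
    intro t ht
    calc qRes φ t = R t * (L + (t : ℂ) • 1) * qRes φ t := by rw [h1 t ht, one_mul]
      _ = R t := by rw [mul_assoc, res_left hL hn ht, mul_one]
  exact ⟨⟨hn, fun t ht => by rw [he t ht]; exact h3 t ht⟩, he⟩

lemma qpos_sub [NeZero n] {φ L : Module.End ℂ (MatC n)} (hL : L * φ = 1) (hL' : φ * L = 1)
    (h : IsQPos φ) {s : ℝ} (hs : 0 ≤ s) :
    IsQPos (qRes φ s) ∧ qLE (qRes φ s) φ := by
  have e : ∀ t : ℝ, L + (s : ℂ) • 1 + (t : ℂ) • (1 : Module.End ℂ (MatC n)) = L + ((s + t : ℝ) : ℂ) • 1 := by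
    intro t; push_cast; rw [add_smul, add_assoc]
  obtain ⟨h1, h2⟩ := qpos_of_inv (φ := qRes φ s) (L := L + (s : ℂ) • 1) (R := fun t => qRes φ (s + t))
    (res_left hL h.1 hs)
    (fun t ht => by rw [e]; exact res_right hL' h.1 (by positivity))
    (fun t ht => h.2 _ (by positivity))
  refine ⟨h1, fun t ht => ?_⟩
  have hst : 0 ≤ s + t := by positivity
  rw [h2 t ht]
  have : qRes φ t - qRes φ (s + t) = (s : ℂ) • (qRes φ t * qRes φ (s + t)) := by
    have a := res_left hL h.1 hst
    have b := res_right hL' h.1 ht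
    calc qRes φ t - qRes φ (s + t)
        = qRes φ t * ((L + ((s + t : ℝ) : ℂ) • 1) * qRes φ (s + t))
          - (qRes φ t * (L + (t : ℂ) • 1)) * qRes φ (s + t) := by rw [a, b, one_mul, mul_one]
      _ = qRes φ t * ((L + ((s + t : ℝ) : ℂ) • 1) - (L + (t : ℂ) • 1)) * qRes φ (s + t) := by
          rw [mul_sub, sub_mul, ← mul_assoc (qRes φ t)]
      _ = _ := by
          have : (L + ((s + t : ℝ) : ℂ) • 1) - (L + (t : ℂ) • 1) = (s : ℂ) • (1 : Module.End ℂ (MatC n)) := by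
            push_cast; rw [add_smul]; abel
          rw [this, mul_smul_comm, mul_one, smul_mul_assoc]
  rw [this]
  exact cp_smul (cp_comp (h.2 t ht) (h.2 _ hst)) hs

lemma qRes_zero (t : ℝ) : qRes (0 : Module.End ℂ (MatC n)) t = 0 := by simp [qRes]

lemma qpos_zero : IsQPos (0 : Module.End ℂ (MatC n)) := by
  refine ⟨fun r hr he => ?_, fun t _ => by rw [qRes_zero]; exact cp_zero⟩
  obtain ⟨A, hA⟩ := he.exists_hasEigenvector
  have := hA.apply_eq_smul
  simp only [LinearMap.zero_apply] at this
  rcases smul_eq_zero.mp this.symm with h | h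
  · exact hr.ne (by exact_mod_cast h)
  · exact hA.2 h

lemma qpure_iff [NeZero n] {φ L : Module.End ℂ (MatC n)} (hL : L * φ = 1) (hL' : φ * L = 1) :
    IsQPure φ ↔ IsQPos φ ∧ ∀ ψ : Module.End ℂ (MatC n), IsQPos ψ → qLE ψ φ →
      (ψ = 0 ∨ ∃ s : ℝ, 0 ≤ s ∧ ψ = qRes φ s) := by
  constructor
  · exact fun h => ⟨h.1, fun ψ h1 h2 => (h.2 ψ).mp ⟨h1, h2⟩⟩
  · refine fun h => ⟨h.1, fun ψ => ⟨fun h' => h.2 ψ h'.1 h'.2, ?_⟩⟩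
    rintro (rfl | ⟨s, hs, rfl⟩)
    · refine ⟨qpos_zero, fun t ht => ?_⟩
      rw [qRes_zero, sub_zero]; exact h.1.2 t ht
    · exact qpos_sub hL hL' h.1 hs

lemma small_R [NeZero n] {φ L : Module.End ℂ (MatC n)} (hL : L * φ = 1) (hL' : φ * L = 1)
    (hone : φ 1 = 1) (h : IsQPos φ) :
    Tendsto (fun t => (choi (qRes φ t)).trace.re) atTop (𝓝 0) := by
  have hL1 : L 1 = 1 := by
    conv_lhs => rw [← hone]
    rw [← Module.End.mul_apply, hL]; rfl
  have h1 : Tendsto (fun t : ℝ => (n : ℝ) * (1 + t)⁻¹) atTop (𝓝 0) := by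
    have := (tendsto_inv_atTop_zero (𝕜 := ℝ)).comp (tendsto_atTop_add_const_left atTop 1 tendsto_id)
    simpa [Function.comp_def] using this.const_mul (n : ℝ)
  refine h1.congr' ?_
  filter_upwards [eventually_ge_atTop 0] with t ht
  have e := congrArg (fun f : Module.End ℂ (MatC n) => f 1) (res_right hL' h.1 ht)
  simp only [Module.End.mul_apply, LinearMap.add_apply, LinearMap.smul_apply, Module.End.one_apply, hL1] at e
  have e1 : (1 : MatC n) + (t : ℂ) • 1 = ((1 + t : ℝ) : ℂ) • 1 := by
    push_cast; rw [add_smul, one_smul]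
  rw [e1, map_smul] at e
  have hne : ((1 + t : ℝ) : ℂ) ≠ 0 := by
    have : (1 + t : ℝ) ≠ 0 := by positivity
    exact_mod_cast this
  have e2 : qRes φ t 1 = (((1 + t)⁻¹ : ℝ) : ℂ) • 1 := by
    rw [Complex.ofReal_inv]
    conv_rhs => rw [← e]
    rw [smul_smul, inv_mul_cancel₀ hne, one_smul]
  rw [trace_choi, e2, Matrix.trace_smul, Matrix.trace_one, smul_eq_mul, Complex.re_ofReal_mul]
  simp [mul_comm]

lemma small_G [NeZero n] {φ L ψ : Module.End ℂ (MatC n)} (hL : L * φ = 1) (hL' : φ * L = 1)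
    (hone : φ 1 = 1) (h : IsQPos φ) (hψ : IsQPos ψ) (hle : qLE ψ φ) :
    Tendsto (fun t => choi (qRes ψ t)) atTop (𝓝 0) := by
  refine psd_small (fun t ht => cp_iff.mp (hψ.2 t ht)) ?_
  refine tendsto_of_tendsto_of_tendsto_of_le_of_le' tendsto_const_nhds (small_R hL hL' hone h) ?_ ?_
  · filter_upwards [eventually_ge_atTop 0] with t ht
    exact (Complex.nonneg_iff.mp (cp_iff.mp (hψ.2 t ht)).trace_nonneg).1
  · filter_upwards [eventually_ge_atTop 0] with t ht
    have := (Complex.nonneg_iff.mp (cp_iff.mp (hle t ht)).trace_nonneg).1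
    rw [choi_sub, Matrix.trace_sub, Complex.sub_re] at this
    linarith

lemma PP_mulVec [NeZero n] : PP n *ᵥ vv n = 0 := by
  have : (n : ℂ) ≠ 0 := by exact_mod_cast NeZero.ne n
  rw [PP, QQ, EE, Matrix.sub_mulVec, Matrix.one_mulVec, Matrix.smul_mulVec]
  ext a
  simp [Matrix.vecMulVec_mulVec, vv_dot, this]
  field_simp
  ring

lemma vecMul_PP [NeZero n] : vv n ᵥ* PP n = 0 := by
  have := congrArg star (PP_mulVec (n := n))
  rwa [Matrix.star_mulVec, star_vv, PP_herm, star_zero] at this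

lemma PP_lyap [NeZero n] (Z : MatC n) : PP n * choi (lyap Z) * PP n = 0 := by
  rw [vec_apply (fun a => Z a.2 a.1) Z (fun _ _ => rfl), mul_add, add_mul,
    Matrix.mul_vecMulVec, Matrix.mul_vecMulVec, Matrix.vecMulVec_mul, Matrix.vecMulVec_mul,
    PP_mulVec, vecMul_PP]
  simp

lemma inv_or_zero [NeZero n] {φ L ψ : Module.End ℂ (MatC n)} (hL : L * φ = 1) (hL' : φ * L = 1)
    (hone : φ 1 = 1) (h : IsQPos φ) (hψ : IsQPos ψ) (hle : qLE ψ φ) :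
    ψ = 0 ∨ IsUnit ψ := by
  by_cases hz : ψ = 0
  · exact Or.inl hz
  right
  have hR0 : Tendsto (fun t => choi (qRes φ t)) atTop (𝓝 0) :=
    psd_small (fun t ht => cp_iff.mp (h.2 t ht)) (small_R hL hL' hone h)
  have hG0 := small_G hL hL' hone h hψ hle
  have hG0' : ∀ A, Tendsto (fun t => qRes ψ t A) atTop (𝓝 0) := by
    rw [← choi_zero, tendsto_choi] at hG0
    simpa using hG0
  have hD := resolvent_lim1 (fun t ht => res_left hL h.1 ht) hR0
  have hsq := squeeze_EE (C := fun t : ℝ => (t : ℂ) • choi (qRes ψ t))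
    (D := fun t : ℝ => (t : ℂ) • choi (qRes φ t))
    (fun t ht => (cp_iff.mp (hψ.2 t ht)).smul (by exact_mod_cast ht))
    (fun t ht => by
      rw [← smul_sub, ← choi_sub]
      exact (cp_iff.mp (hle t ht)).smul (by exact_mod_cast ht)) hD
    (by rw [PP_mul_EE, zero_mul])
  obtain ⟨l, hl⟩ : ∃ l : ℝ → ℂ, ∀ t : ℝ, l t =
    (n : ℂ)⁻¹ ^ 2 * (vv n ⬝ᵥ (((t : ℂ) • choi (qRes ψ t)) *ᵥ vv n)) := ⟨_, fun _ => rfl⟩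
  simp only [← hl] at hsq
  have hA : ∀ A, Tendsto (fun t : ℝ => (t : ℂ) • qRes ψ t A - l t • A) atTop (𝓝 0) := by
    have := (tendsto_choi (R := fun t : ℝ => (t : ℂ) • qRes ψ t - l t • 1) (S := 0)).mp (by
      rw [choi_zero]
      simpa only [choi_sub, choi_smul, choi_one] using hsq)
    simpa using this
  have hc : Continuous ψ := LinearMap.continuous_of_finiteDimensional ψ
  have hB : ∀ A, Tendsto (fun t : ℝ => (1 - l t) • ψ A) atTop (𝓝 0) := by
    intro A
    have h1 := ((hc.tendsto 0).comp (hA A)).add (hG0' A)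
    rw [map_zero, add_zero] at h1
    refine h1.congr' ?_
    filter_upwards [eventually_ge_atTop 0] with t ht
    have e := congrArg (fun f : Module.End ℂ (MatC n) => f A) (qRes_left hψ.1 ht)
    simp only [Module.End.mul_apply, LinearMap.add_apply, LinearMap.smul_apply, Module.End.one_apply] at e
    simp only [Function.comp, map_sub, map_smul, sub_smul, one_smul]
    have e' : (t : ℂ) • ψ (qRes ψ t A) = ψ A - qRes ψ t A := eq_sub_of_add_eq' e
    rw [e']; abel
  obtain ⟨A, hAne⟩ : ∃ A, ψ A ≠ 0 := by
    by_contra hcon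
    push Not at hcon
    exact hz (LinearMap.ext hcon)
  obtain ⟨i, j, hij⟩ : ∃ i j, ψ A i j ≠ 0 := by
    by_contra hcon
    push Not at hcon
    exact hAne (by ext i j; exact hcon i j)
  have hl1 : Tendsto (fun t => 1 - l t) atTop (𝓝 0) := by
    have := (tendsto_matrix.mp (hB A) i j).mul_const (ψ A i j)⁻¹
    simpa [mul_assoc, mul_inv_cancel₀ hij] using this
  rw [LinearMap.isUnit_iff_ker_eq_bot, LinearMap.ker_eq_bot']
  intro B hB0
  have h1 : Tendsto (fun t : ℝ => (1 - l t) • B) atTop (𝓝 ((0 : ℂ) • B)) := hl1.smul_const B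
  have h2 : Tendsto (fun t : ℝ => (1 - l t) • B) atTop (𝓝 B) := by
    have := (hA B).const_add B
    rw [add_zero] at this
    refine this.congr' ?_
    filter_upwards [eventually_ge_atTop 0] with t ht
    have e := congrArg (fun f : Module.End ℂ (MatC n) => f B) (qRes_right hψ.1 ht)
    simp only [Module.End.mul_apply, LinearMap.add_apply, LinearMap.smul_apply, Module.End.one_apply,
      hB0, smul_zero, add_zero] at e
    rw [e, smul_zero, sub_smul, one_smul]; abel
  have := tendsto_nhds_unique h2 h1
  rwa [zero_smul] at this

lemma key [NeZero n] {φ ψ : Module.End ℂ (MatC n)} {Z : MatC n} (hL : lyap Z * φ = 1)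
    (hL' : φ * lyap Z = 1)
    (hone : φ 1 = 1) (h : IsQPos φ) (hψ : IsQPos ψ) (hle : qLE ψ φ) :
    ψ = 0 ∨ ∃ s : ℝ, 0 ≤ s ∧ ψ = qRes φ s := by
  rcases inv_or_zero hL hL' hone h hψ hle with h0 | hu
  · exact Or.inl h0
  right
  have hR0 : Tendsto (fun t => choi (qRes φ t)) atTop (𝓝 0) :=
    psd_small (fun t ht => cp_iff.mp (h.2 t ht)) (small_R hL hL' hone h)
  have hG0 := small_G hL hL' hone h hψ hle
  have hM : Ring.inverse ψ * ψ = 1 := Ring.inverse_mul_cancel _ hu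
  have hM' : ψ * Ring.inverse ψ = 1 := Ring.mul_inverse_cancel _ hu
  set M := Ring.inverse ψ with hMdef
  have l1 := resolvent_lim (fun t ht => res_left hL h.1 ht) hR0
  have l2 := resolvent_lim (fun t ht => res_left hM hψ.1 ht) hG0
  have l3 := l1.sub l2
  have hS : (choi (M - lyap Z)).PosSemidef := by
    have e : choi (M - lyap Z) = - choi (lyap Z) - - choi M := by rw [choi_sub]; abel
    rw [e]
    refine psd_lim ?_ l3
    intro t ht
    have e2 : (t : ℂ) ^ 2 • choi (qRes φ t) - (t : ℂ) • EE n - ((t : ℂ) ^ 2 • choi (qRes ψ t) - (t : ℂ) • EE n)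
       = (t : ℂ) ^ 2 • choi (qRes φ t - qRes ψ t) := by
      rw [choi_sub, smul_sub]; abel
    rw [e2]
    refine (cp_iff.mp (hle t ht)).smul ?_
    rw [← Complex.ofReal_pow]
    exact_mod_cast sq_nonneg t
  have hP : PP n * choi (M - lyap Z) * PP n = 0 := by
    apply psd_antisymm
    · have := hS.conjTranspose_mul_mul_same (PP n)
      rwa [PP_herm] at this
    · rw [choi_sub, mul_sub, sub_mul, PP_lyap, sub_zero]
      exact cond_neg (fun t ht => res_left hM hψ.1 ht) hψ.2 hG0
  obtain ⟨s, hs, hse⟩ := eq_smul_one hS hP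
  refine ⟨s, hs, ?_⟩
  have hMe : M = lyap Z + (s : ℂ) • 1 := by rw [← hse]; abel
  have := res_right hL' h.1 hs
  rw [← hMe] at this
  calc ψ = (qRes φ s * M) * ψ := by rw [this, one_mul]
    _ = qRes φ s := by rw [mul_assoc, hM, mul_one]

end qres

section final

open Filter Topology

variable {n : ℕ}

lemma lyap_add_smul (B : MatC n) (t : ℝ) :
    lyap (B + ((t / 2 : ℝ) : ℂ) • 1) = lyap B + (t : ℂ) • 1 := by
  ext1 A
  simp only [lyap_apply, LinearMap.add_apply, LinearMap.smul_apply, Module.End.one_apply,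
    Matrix.conjTranspose_add, Matrix.conjTranspose_smul, Matrix.conjTranspose_one, add_mul, mul_add,
    Matrix.smul_mul, Matrix.mul_smul, one_mul, mul_one]
  have e : (t : ℂ) • A = ((t / 2 : ℝ) : ℂ) • A + ((t / 2 : ℝ) : ℂ) • A := by
    rw [← add_smul]; congr 1; push_cast; ring
  have e2 : star ((t / 2 : ℝ) : ℂ) = ((t / 2 : ℝ) : ℂ) := Complex.conj_ofReal _
  rw [e, e2]; abel

lemma herm_add_smul (B : MatC n) (t : ℝ) :
    (B + ((t / 2 : ℝ) : ℂ) • 1) + (B + ((t / 2 : ℝ) : ℂ) • 1)ᴴ = (B + Bᴴ) + (t : ℂ) • 1 := by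
  have := congrArg (fun f : Module.End ℂ (MatC n) => f 1) (lyap_add_smul B t)
  simpa only [lyap_apply, LinearMap.add_apply, LinearMap.smul_apply, Module.End.one_apply, mul_one,
    one_mul] using this

lemma lyap_resolvent [NeZero n] {B : MatC n} (hB : (B + Bᴴ).PosDef) :
    ∃ R : ℝ → Module.End ℂ (MatC n), ∀ t : ℝ, 0 ≤ t →
      (lyap B + (t : ℂ) • 1) * R t = 1 ∧ R t * (lyap B + (t : ℂ) • 1) = 1 ∧ IsCP (R t) := by
  have : ∀ t : ℝ, ∃ R : Module.End ℂ (MatC n), 0 ≤ t →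
      (lyap B + (t : ℂ) • 1) * R = 1 ∧ R * (lyap B + (t : ℂ) • 1) = 1 ∧ IsCP R := by
    intro t
    by_cases ht : 0 ≤ t
    · have h2 : ((B + ((t / 2 : ℝ) : ℂ) • 1) + (B + ((t / 2 : ℝ) : ℂ) • 1)ᴴ).PosDef := by
        rw [herm_add_smul]
        exact hB.add_posSemidef (Matrix.PosSemidef.one.smul (by exact_mod_cast ht))
      obtain ⟨R, hR⟩ := lyap_inverse h2
      rw [lyap_add_smul] at hR
      exact ⟨R, fun _ => hR⟩
    · exact ⟨0, fun h => absurd h ht⟩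
  choose R hR using this
  exact ⟨R, hR⟩

lemma split_herm {L : Module.End ℂ (MatC n)} (hC : (choi L).IsHermitian) :
    ∃ Z : MatC n, choi (lyap Z - L) = -(PP n * choi L * PP n) := by
  obtain ⟨w, hw⟩ : ∃ w : Fin n × Fin n → ℂ, w = (n : ℂ)⁻¹ • (choi L *ᵥ vv n)
      - ((1 / 2 : ℂ) * ((n : ℂ)⁻¹ ^ 2 * (vv n ⬝ᵥ (choi L *ᵥ vv n)))) • vv n := ⟨_, rfl⟩
  refine ⟨Matrix.of fun k i => w (i, k), ?_⟩
  have hX : Matrix.vecMulVec w (vv n) = choi L * QQ n - (1 / 2 : ℂ) • (QQ n * choi L * QQ n) := by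
    rw [QQ_mul_mul_QQ, hw, QQ, EE, Matrix.mul_smul, Matrix.mul_vecMulVec]
    ext a b
    simp only [Matrix.vecMulVec_apply, Matrix.sub_apply, Matrix.smul_apply, Pi.sub_apply, Pi.smul_apply,
      smul_eq_mul]
    ring
  have hX' : Matrix.vecMulVec (vv n) (star w) = (Matrix.vecMulVec w (vv n))ᴴ := by
    rw [Matrix.conjTranspose_vecMulVec, star_vv]
  have h2 : star (1 / 2 : ℂ) = 1 / 2 := by simp
  rw [choi_sub, vec_apply w (Matrix.of fun k i => w (i, k)) (fun _ _ => rfl), hX', hX, Matrix.conjTranspose_sub,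
    Matrix.conjTranspose_smul, Matrix.conjTranspose_mul, Matrix.conjTranspose_mul,
    Matrix.conjTranspose_mul, QQ_herm, hC.eq, h2, PP]
  have e : QQ n * choi L * QQ n = (1 / 2 : ℂ) • (QQ n * choi L * QQ n) + (1 / 2 : ℂ) • (QQ n * choi L * QQ n) := by
    rw [← add_smul]; norm_num
  rw [← mul_assoc]
  simp only [sub_mul, mul_sub, one_mul, mul_one]
  nth_rewrite 3 [e]
  abel

lemma forward [NeZero n] {φ L : Module.End ℂ (MatC n)} (hL : L * φ = 1) (hL' : φ * L = 1)
    (hone : φ 1 = 1) (hq : IsQPure φ) :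
    ∃ Z : MatC n, L = lyap Z := by
  have hq' := (qpure_iff hL hL').mp hq
  obtain ⟨h, hsub⟩ := hq'
  have hL1 : L 1 = 1 := by
    conv_lhs => rw [← hone]
    rw [← Module.End.mul_apply, hL]; rfl
  have hR0 : Tendsto (fun t => choi (qRes φ t)) atTop (𝓝 0) :=
    psd_small (fun t ht => cp_iff.mp (h.2 t ht)) (small_R hL hL' hone h)
  have hH := choi_herm (fun t ht => res_left hL h.1 ht) h.2 hR0
  have hN := cond_neg (fun t ht => res_left hL h.1 ht) h.2 hR0
  obtain ⟨Z, hZ⟩ := split_herm hH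
  refine ⟨Z, ?_⟩
  have hS : IsCP (lyap Z - L) := by rw [cp_iff, hZ]; exact hN
  have hpd : (Z + Zᴴ).PosDef := by
    obtain ⟨K, hK⟩ := kraus_of_psd (cp_iff.mp hS)
    have e := hK 1
    rw [LinearMap.sub_apply, hL1, lyap_apply, mul_one, one_mul, sub_eq_iff_eq_add'] at e
    rw [e]
    refine Matrix.PosDef.one.add_posSemidef (Matrix.posSemidef_sum _ fun p _ => ?_)
    rw [mul_one]
    exact Matrix.posSemidef_self_mul_conjTranspose _
  obtain ⟨R, hR⟩ := lyap_resolvent hpd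
  have h0 := hR 0 le_rfl
  simp only [Complex.ofReal_zero, zero_smul, add_zero] at h0
  obtain ⟨hpos, hres⟩ := qpos_of_inv (φ := R 0) (L := lyap Z) (R := R) h0.1
    (fun t ht => (hR t ht).2.1) (fun t ht => (hR t ht).2.2)
  have hle : qLE (R 0) φ := by
    intro t ht
    rw [hres t ht]
    have e : qRes φ t - R t = qRes φ t * (lyap Z - L) * R t := by
      have a := res_right hL' h.1 ht
      have b := (hR t ht).1
      have c : lyap Z - L = (lyap Z + (t : ℂ) • 1) - (L + (t : ℂ) • 1) := by abel
      rw [c, mul_sub, sub_mul, a, one_mul, mul_assoc, b, mul_one]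
    rw [e]
    exact cp_comp (cp_comp (h.2 t ht) hS) (hR t ht).2.2
  rcases hsub _ hpos hle with hz | ⟨s, hs, hse⟩
  · exfalso
    rw [hz, mul_zero] at h0
    have := congrArg (fun f : Module.End ℂ (MatC n) => f 1 0 0) h0.1
    simp at this
  · have hM : lyap Z = L + (s : ℂ) • 1 := by
      calc lyap Z = ((L + (s : ℂ) • 1) * qRes φ s) * lyap Z := by rw [res_left hL h.1 hs, one_mul]
        _ = L + (s : ℂ) • 1 := by rw [← hse, mul_assoc, h0.2.1, mul_one]
    have e1 : lyap Z - L = (s : ℂ) • 1 := by rw [hM]; abel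
    rw [e1, choi_smul, choi_one] at hZ
    have e2 := congrArg (fun X => EE n * X) hZ
    simp only [Matrix.mul_smul, EE_mul_EE, mul_neg, ← mul_assoc, EE_mul_PP, zero_mul, neg_zero,
      smul_smul] at e2
    have hn : (n : ℂ) ≠ 0 := by exact_mod_cast NeZero.ne n
    rcases smul_eq_zero.mp e2 with e3 | e3
    · rcases mul_eq_zero.mp e3 with e4 | e4
      · rw [hM, e4, zero_smul, add_zero]
      · exact absurd e4 hn
    · exact absurd e3 EE_ne_zero

lemma main_pos [NeZero n] (φ : Module.End ℂ (MatC n))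
    (hinv : IsUnit φ) (hone : φ 1 = 1) :
    IsQPure φ ↔ ∃ Y : MatC n, Yᴴ = -Y ∧ Y.trace = 0 ∧
      ∀ A : MatC n, Ring.inverse φ A = A + Y * A + A * Yᴴ := by
  have hL : Ring.inverse φ * φ = 1 := Ring.inverse_mul_cancel _ hinv
  have hL' : φ * Ring.inverse φ = 1 := Ring.mul_inverse_cancel _ hinv
  have hn : (n : ℂ) ≠ 0 := by exact_mod_cast NeZero.ne n
  set L := Ring.inverse φ with hLdef
  have hL1 : L 1 = 1 := by
    conv_lhs => rw [← hone]
    rw [← Module.End.mul_apply, hL]; rfl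
  constructor
  · intro hq
    obtain ⟨Z, hZ⟩ := forward hL hL' hone hq
    have hsum : Z + Zᴴ = 1 := by
      rw [hZ, lyap_apply, mul_one, one_mul] at hL1; exact hL1
    have hZH : Zᴴ = 1 - Z := eq_sub_of_add_eq' hsum
    obtain ⟨c, hc⟩ : ∃ c : ℂ, c = Z.trace / n := ⟨_, rfl⟩
    have hcs : star c = 1 - c := by
      have h1 := congrArg Matrix.trace hZH
      rw [Matrix.trace_conjTranspose, Matrix.trace_sub, Matrix.trace_one, Fintype.card_fin] at h1
      rw [hc, star_div₀, h1, star_natCast]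
      field_simp
    have hYH : (Z - c • 1)ᴴ = -(Z - c • 1) := by
      rw [Matrix.conjTranspose_sub, Matrix.conjTranspose_smul, hcs, hZH, Matrix.conjTranspose_one,
        sub_smul, one_smul]
      abel
    refine ⟨Z - c • 1, hYH, ?_, fun A => ?_⟩
    · rw [Matrix.trace_sub, Matrix.trace_smul, Matrix.trace_one, Fintype.card_fin, hc, smul_eq_mul,
        div_mul_cancel₀ _ hn, sub_self]
    · rw [hYH, hZ, lyap_apply, hZH]
      simp only [sub_mul, mul_sub, mul_neg, Matrix.smul_mul, Matrix.mul_smul, one_mul, mul_one]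
      abel
  · rintro ⟨Y, hY, -, hA⟩
    have hLe : L = lyap (Y + ((1 / 2 : ℝ) : ℂ) • 1) := by
      rw [lyap_add_smul]
      ext1 A
      rw [hA, LinearMap.add_apply, lyap_apply]
      simp only [Complex.ofReal_one, one_smul, Module.End.one_apply]
      abel
    have hpd : ((Y + ((1 / 2 : ℝ) : ℂ) • 1) + (Y + ((1 / 2 : ℝ) : ℂ) • 1)ᴴ).PosDef := by
      rw [herm_add_smul, hY, add_neg_cancel, zero_add, Complex.ofReal_one, one_smul]
      exact Matrix.PosDef.one
    generalize Y + ((1 / 2 : ℝ) : ℂ) • 1 = Z at hLe hpd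
    obtain ⟨R, hR⟩ := lyap_resolvent hpd
    rw [hLe] at hL hL'
    obtain ⟨hpos, -⟩ := qpos_of_inv (R := R) hL (fun t ht => (hR t ht).2.1) (fun t ht => (hR t ht).2.2)
    exact (qpure_iff hL hL').mpr ⟨hpos, fun ψ h1 h2 => key hL hL' hone hpos h1 h2⟩

lemma main_zero (φ : Module.End ℂ (MatC 0)) : IsQPure φ := by
  have hs : ∀ a b : Module.End ℂ (MatC 0), a = b := by
    intro a b; ext A i; exact i.elim0
  have hp : ∀ a : Module.End ℂ (MatC 0), IsQPos a := fun a => by rw [hs a 0]; exact qpos_zero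
  refine ⟨hp φ, fun ψ => ⟨fun _ => Or.inl (hs _ _), fun _ => ⟨hp ψ, fun t _ => ?_⟩⟩⟩
  rw [hs (qRes φ t - qRes ψ t) 0]; exact cp_zero

end final

/-- An invertible unital map `φ` is q-pure iff `φ⁻¹(A) = A + YA + AY*` for some
skew-adjoint traceless `Y`. -/
theorem stmt16 {n : ℕ} (φ : Module.End ℂ (MatC n))
    (hinv : IsUnit φ) (hone : φ 1 = 1) :
    IsQPure φ ↔ ∃ Y : MatC n, Yᴴ = -Y ∧ Y.trace = 0 ∧
      ∀ A : MatC n, Ring.inverse φ A = A + Y * A + A * Yᴴ := by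
  rcases Nat.eq_zero_or_pos n with h0 | h0
  · subst h0
    refine ⟨fun _ => ⟨0, by simp, by simp, fun A => ?_⟩, fun _ => main_zero φ⟩
    ext i; exact i.elim0
  · haveI : NeZero n := ⟨h0.ne'⟩
    exact main_pos φ hinv hone
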